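/- arXiv:1612.02185 — 2 statements merged into one kernel-verified Lean document; each statement's English description precedes it below -/
import Mathlib

section
/- Let X be a conjugacy class of involutions in G_n (n ≥ 2) with labelled cycle type (m,k_e,k_o,l). Then the commuting involution graph C(G_n,X) is disconnected if and only if one of the following holds: (i) m = 0 and l = 0; (ii) m > 0, l = 0 and either k_e = 1 or k_o = 1; (iii) m > 0 and max(k_e,k_o,l) = 1; (iv) n = 4 and m = 1; (v) n = 6, m = 1 and k_e = k_o = 2. -/
/-!
Common setup: the affine Weyl group of type C̃ₙ, realized as the semidirect
product of the group Wₙ of signed permutations of {1,…,n} with the translation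
lattice ℤⁿ.  An element is a triple `(π, s, v)`, where `π` is the underlying
permutation of the n points, `s i` is the sign attached to the point `i`
(so the signed permutation maps the point `i` to the point `π i` with sign `s i`),
and `v ∈ ℤⁿ` is the translation part.  The multiplication realizes
`(α,v)(τ,u) = (ατ, vᵗ + u)`.
-/

/-- An element of the affine Weyl group of type C̃ₙ: a signed permutation
`(π, s)` together with a translation vector `v ∈ ℤⁿ`. -/
@[ext]
structure AffineWeylC (n : ℕ) where
  π : Equiv.Perm (Fin n)
  s : Fin n → ℤˣ
  v : Fin n → ℤ

namespace AffineWeylC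

variable {n : ℕ}

instance : One (AffineWeylC n) := ⟨⟨1, 1, 0⟩⟩

instance : Mul (AffineWeylC n) :=
  ⟨fun g h => ⟨h.π * g.π, fun j => g.s j * h.s (g.π j),
    fun i => (h.s (h.π⁻¹ i) : ℤ) * g.v (h.π⁻¹ i) + h.v i⟩⟩

instance : Inv (AffineWeylC n) :=
  ⟨fun g => ⟨g.π⁻¹, fun k => (g.s (g.π⁻¹ k))⁻¹,
    fun i => -(((g.s i)⁻¹ : ℤˣ) : ℤ) * g.v (g.π i)⟩⟩

@[simp] lemma mul_π (g h : AffineWeylC n) : (g * h).π = h.π * g.π := rfl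
@[simp] lemma mul_s (g h : AffineWeylC n) (j : Fin n) :
    (g * h).s j = g.s j * h.s (g.π j) := rfl
@[simp] lemma mul_v (g h : AffineWeylC n) (i : Fin n) :
    (g * h).v i = (h.s (h.π⁻¹ i) : ℤ) * g.v (h.π⁻¹ i) + h.v i := rfl
@[simp] lemma one_π : (1 : AffineWeylC n).π = 1 := rfl
@[simp] lemma one_s (j : Fin n) : (1 : AffineWeylC n).s j = 1 := rfl
@[simp] lemma one_v (i : Fin n) : (1 : AffineWeylC n).v i = 0 := rfl
@[simp] lemma inv_π (g : AffineWeylC n) : g⁻¹.π = g.π⁻¹ := rfl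
@[simp] lemma inv_s (g : AffineWeylC n) (k : Fin n) :
    g⁻¹.s k = (g.s (g.π⁻¹ k))⁻¹ := rfl
@[simp] lemma inv_v (g : AffineWeylC n) (i : Fin n) :
    g⁻¹.v i = -(((g.s i)⁻¹ : ℤˣ) : ℤ) * g.v (g.π i) := rfl

instance : Group (AffineWeylC n) where
  mul_assoc a b c := by
    refine AffineWeylC.ext ?_ (funext fun j => ?_) (funext fun i => ?_)
    · simp [mul_assoc]
    · simp only [mul_s, mul_π, Equiv.Perm.mul_apply]
      rw [mul_assoc]
    · simp only [mul_v, mul_s, mul_π, mul_inv_rev, Equiv.Perm.mul_apply,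
        show ∀ x, b.π (b.π⁻¹ x) = x from b.π.apply_symm_apply, Units.val_mul]
      ring
  one_mul a := by
    refine AffineWeylC.ext ?_ (funext fun j => ?_) (funext fun i => ?_) <;>
      simp
  mul_one a := by
    refine AffineWeylC.ext ?_ (funext fun j => ?_) (funext fun i => ?_) <;>
      simp
  inv_mul_cancel a := by
    refine AffineWeylC.ext ?_ (funext fun j => ?_) (funext fun i => ?_)
    · simp
    · simp
    · simp only [mul_v, inv_v, inv_s, one_v,
        show a.π (a.π⁻¹ i) = i from a.π.apply_symm_apply i]
      have h1 : ((a.s (a.π⁻¹ i) : ℤ)) * (((a.s (a.π⁻¹ i))⁻¹ : ℤˣ) : ℤ) = 1 := by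
        rw [← Units.val_mul, mul_inv_cancel, Units.val_one]
      linear_combination (-(a.v i)) * h1

/-- `g` is an involution: a non-identity element squaring to the identity. -/
def Involution (g : AffineWeylC n) : Prop := g ≠ 1 ∧ g * g = 1

/-- The conjugacy class of `a`. -/
def conjClass (a : AffineWeylC n) : Set (AffineWeylC n) := {b | IsConj a b}

/-- The number of transpositions (2-cycles) of the underlying signed permutation. -/
noncomputable def numTrans (g : AffineWeylC n) : ℕ :=
  {i : Fin n | g.π i ≠ i}.ncard / 2

/-- The number of negative 1-cycles of `g` carrying an even label. -/
noncomputable def numNegEven (g : AffineWeylC n) : ℕ :=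
  {i : Fin n | g.π i = i ∧ g.s i = -1 ∧ Even (g.v i)}.ncard

/-- The number of negative 1-cycles of `g` carrying an odd label. -/
noncomputable def numNegOdd (g : AffineWeylC n) : ℕ :=
  {i : Fin n | g.π i = i ∧ g.s i = -1 ∧ Odd (g.v i)}.ncard

/-- The number of positive 1-cycles (fixed points) of `g`. -/
noncomputable def numPos (g : AffineWeylC n) : ℕ :=
  {i : Fin n | g.π i = i ∧ g.s i = 1}.ncard

/-- The labelled cycle type `(m, k_e, k_o, l)` of an involution. -/
noncomputable def cycleType (g : AffineWeylC n) : ℕ × ℕ × ℕ × ℕ :=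
  (numTrans g, numNegEven g, numNegOdd g, numPos g)

/-- `g` has labelled cycle type `(m, k_e, k_o, l)`. -/
def HasType (g : AffineWeylC n) (m ke ko l : ℕ) : Prop :=
  numTrans g = m ∧ numNegEven g = ke ∧ numNegOdd g = ko ∧ numPos g = l

/-- The canonical class representative
`a_{m,k_e,k_o,l} = (1 2)⁺₀ ⋯ (2m−1 2m)⁺₀ (2m+1)⁻₀ ⋯ (2m+k_e)⁻₀
(2m+k_e+1)⁻₁ ⋯ (n−l)⁻₁ (n−l+1)⁺₀ ⋯ (n)⁺₀`
(here written with 0-based indices): points `0,…,2m-1` are paired off into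
label‑0 positive transpositions, points `2m,…,2m+k_e-1` are negative 1-cycles
with label 0, points `2m+k_e,…,2m+k_e+k_o-1` are negative 1-cycles with label 1,
and the remaining `l` points are positive fixed points with label 0. -/
def IsCanon (a : AffineWeylC n) (m ke ko l : ℕ) : Prop :=
  2*m + ke + ko + l = n ∧
  (∀ i : Fin n, i.val < 2*m → i.val % 2 = 0 → (a.π i).val = i.val + 1) ∧
  (∀ i : Fin n, i.val < 2*m → i.val % 2 = 1 → (a.π i).val = i.val - 1) ∧
  (∀ i : Fin n, 2*m ≤ i.val → a.π i = i) ∧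
  (∀ i : Fin n, i.val < 2*m → a.s i = 1 ∧ a.v i = 0) ∧
  (∀ i : Fin n, 2*m ≤ i.val → i.val < 2*m + ke → a.s i = -1 ∧ a.v i = 0) ∧
  (∀ i : Fin n, 2*m + ke ≤ i.val → i.val < 2*m + ke + ko → a.s i = -1 ∧ a.v i = 1) ∧
  (∀ i : Fin n, 2*m + ke + ko ≤ i.val → a.s i = 1 ∧ a.v i = 0)

/-- The labelled positive transposition `(α β)⁺_λ`. -/
def posTrans (α β : Fin n) (lam : ℤ) : AffineWeylC n :=
  ⟨Equiv.swap α β, 1, fun i => if i = α then lam else if i = β then -lam else 0⟩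

/-- The labelled negative transposition `(α β)⁻_λ`. -/
def negTrans (α β : Fin n) (lam : ℤ) : AffineWeylC n :=
  ⟨Equiv.swap α β, fun i => if i = α then -1 else if i = β then -1 else 1,
    fun i => if i = α then lam else if i = β then lam else 0⟩

/-- The labelled negative 1-cycle `(α)⁻_λ`. -/
def negOne (α : Fin n) (lam : ℤ) : AffineWeylC n :=
  ⟨1, fun i => if i = α then -1 else 1, fun i => if i = α then lam else 0⟩

/-- The finite Weyl group Wₙ of type Cₙ, as the subgroup of the affine Weyl
group consisting of the elements with trivial translation part. -/
def WeylSub (n : ℕ) : Subgroup (AffineWeylC n) where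
  carrier := {g | g.v = 0}
  one_mem' := rfl
  mul_mem' := by
    intro g h hg hh
    show (g * h).v = 0
    funext i
    simp only [mul_v]
    rw [show g.v = 0 from hg, show h.v = 0 from hh]
    simp
  inv_mem' := by
    intro g hg
    show g⁻¹.v = 0
    funext i
    simp only [inv_v]
    rw [show g.v = 0 from hg]
    simp

/-- The projection `G_n → W_n`, `(σ, v) ↦ σ`. -/
def weylPart (n : ℕ) : AffineWeylC n →* WeylSub n where
  toFun g := ⟨⟨g.π, g.s, 0⟩, rfl⟩
  map_one' := by
    apply Subtype.ext
    refine AffineWeylC.ext rfl rfl rfl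
  map_mul' g h := by
    apply Subtype.ext
    refine AffineWeylC.ext rfl rfl (funext fun i => ?_)
    simp

end AffineWeylC

/-- The commuting graph on a subset `X` of a group: the vertices are the
elements of `X`, and distinct vertices are adjacent iff they commute. -/
def commGraph {G : Type*} [Group G] (X : Set G) : SimpleGraph X where
  Adj x y := (x : G) ≠ (y : G) ∧ Commute (x : G) (y : G)
  symm := ⟨fun _ _ h => ⟨fun e => h.1 e.symm, h.2.symm⟩⟩
  loopless := ⟨fun _ h => h.1 rfl⟩

namespace AffineWeylC

variable {n : ℕ}

/-- The kind of a point with respect to an involution: the type of the labelled cycle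
containing it. -/
inductive PointKind
  | moved
  | negEven
  | negOdd
  | pos

open Classical in
/-- The kind of the point `i` with respect to `g`. -/
noncomputable def kind (g : AffineWeylC n) (i : Fin n) : PointKind :=
  if g.π i ≠ i then .moved
  else if g.s i = 1 then .pos
  else if Even (g.v i) then .negEven
  else .negOdd

/-- The number of points of a given kind. -/
noncomputable def kindCount (g : AffineWeylC n) (c : PointKind) : ℕ :=
  {i | kind g i = c}.ncard

lemma kind_eq_moved_iff (g : AffineWeylC n) (i : Fin n) :
    kind g i = .moved ↔ g.π i ≠ i := by
  unfold kind; split_ifs <;> simp_all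

lemma kind_eq_negEven_iff (g : AffineWeylC n) (i : Fin n) :
    kind g i = .negEven ↔ g.π i = i ∧ g.s i = -1 ∧ Even (g.v i) := by
  unfold kind
  rcases Int.units_eq_one_or (g.s i) with h | h <;> split_ifs <;> simp_all

lemma kind_eq_negOdd_iff (g : AffineWeylC n) (i : Fin n) :
    kind g i = .negOdd ↔ g.π i = i ∧ g.s i = -1 ∧ Odd (g.v i) := by
  unfold kind
  rcases Int.units_eq_one_or (g.s i) with h | h <;> split_ifs <;> simp_all

lemma kind_eq_pos_iff (g : AffineWeylC n) (i : Fin n) :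
    kind g i = .pos ↔ g.π i = i ∧ g.s i = 1 := by
  unfold kind
  rcases Int.units_eq_one_or (g.s i) with h | h <;> split_ifs <;> simp_all

lemma kindCount_add (g : AffineWeylC n) :
    kindCount g .moved + kindCount g .negEven + kindCount g .negOdd + kindCount g .pos = n := by
  classical
  have h : ∀ c, kindCount g c = ∑ i, if kind g i = c then 1 else 0 := by
    intro c
    rw [kindCount, Set.ncard_eq_toFinset_card', Finset.sum_boole]
    simp
  simp only [h, ← Finset.sum_add_distrib]
  rw [Finset.sum_congr rfl (g := fun _ => 1)]
  · simp
  · intro i _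
    cases kind g i <;> simp

lemma HasType.kindCount {g : AffineWeylC n} {m ke ko l : ℕ} (h : g.HasType m ke ko l)
    (hsum : 2 * m + ke + ko + l = n) :
    kindCount g .moved = 2 * m ∧ kindCount g .negEven = ke ∧ kindCount g .negOdd = ko ∧
      kindCount g .pos = l := by
  obtain ⟨-, h2, h3, h4⟩ := h
  have h2' : AffineWeylC.kindCount g .negEven = ke := by
    simpa only [AffineWeylC.kindCount, kind_eq_negEven_iff, numNegEven] using h2
  have h3' : AffineWeylC.kindCount g .negOdd = ko := by
    simpa only [AffineWeylC.kindCount, kind_eq_negOdd_iff, numNegOdd] using h3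
  have h4' : AffineWeylC.kindCount g .pos = l := by
    simpa only [AffineWeylC.kindCount, kind_eq_pos_iff, numPos] using h4
  have := kindCount_add g
  refine ⟨?_, h2', h3', h4'⟩
  omega

lemma conj_s (g a : AffineWeylC n) (i : Fin n) :
    (g * a * g⁻¹).s i = g.s i * a.s (g.π i) * (g.s (g.π⁻¹ (a.π (g.π i))))⁻¹ := by
  simp [mul_assoc]

lemma conj_v (g a : AffineWeylC n) (i : Fin n) :
    (g * a * g⁻¹).v i = g.s i * (a.s (a.π⁻¹ (g.π i)) * g.v (a.π⁻¹ (g.π i)) + a.v (g.π i)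
      - g.v (g.π i)) := by
  simp
  ring

lemma kind_conj (g a : AffineWeylC n) (i : Fin n) :
    kind (g * a * g⁻¹) i = kind a (g.π i) := by
  have hπ : (g * a * g⁻¹).π i = g.π⁻¹ (a.π (g.π i)) := rfl
  by_cases h : a.π (g.π i) = g.π i
  · have hs : (g * a * g⁻¹).s i = a.s (g.π i) := by
      rw [conj_s, h]; simp [mul_right_comm]
    have h' : a.π⁻¹ (g.π i) = g.π i := by rw [Equiv.Perm.inv_eq_iff_eq, h]
    have hv := conj_v g a i
    rw [h'] at hv
    rcases Int.units_eq_one_or (a.s (g.π i)) with e | e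
    · rw [(kind_eq_pos_iff _ _).2 ⟨h, e⟩, kind_eq_pos_iff]
      simp [h, hs, e]
    · have hpar : Even ((g * a * g⁻¹).v i) ↔ Even (a.v (g.π i)) := by
        rw [hv, e]
        rcases Int.units_eq_one_or (g.s i) with e' | e' <;> simp [e', parity_simps] <;> tauto
      by_cases he : Even (a.v (g.π i))
      · rw [(kind_eq_negEven_iff _ _).2 ⟨h, e, he⟩, kind_eq_negEven_iff]
        exact ⟨by simp [h], by simp [hs, e], hpar.2 he⟩
      · rw [(kind_eq_negOdd_iff _ _).2 ⟨h, e, Int.not_even_iff_odd.1 he⟩, kind_eq_negOdd_iff]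
        refine ⟨by simp [h], by simp [hs, e], ?_⟩
        rw [← Int.not_even_iff_odd, hpar]
        exact he
  · rw [(kind_eq_moved_iff _ _).2 h, kind_eq_moved_iff, hπ, Ne, Equiv.Perm.inv_eq_iff_eq]
    exact h

lemma kindCount_conj (g a : AffineWeylC n) (c : PointKind) :
    kindCount (g * a * g⁻¹) c = kindCount a c := by
  simp only [kindCount, kind_conj]
  exact Set.ncard_preimage_of_injective_subset_range (s := {i | kind a i = c}) g.π.injective
    (by simp)

lemma kindCount_of_mem_conjClass {a b : AffineWeylC n} (h : b ∈ conjClass a) (c : PointKind) :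
    kindCount b c = kindCount a c := by
  obtain ⟨g, rfl⟩ := isConj_iff.1 h
  exact kindCount_conj g a c

lemma kind_apply_of_commute {b y : AffineWeylC n} (h : Commute b y) (i : Fin n) :
    kind b (y.π i) = kind b i := by
  rw [← kind_conj, ← h.eq, mul_inv_cancel_right]

/-- Two commuting elements that both invert the point `i` agree on its label. -/
lemma v_eq_of_commute {b y : AffineWeylC n} (h : Commute b y) {i : Fin n}
    (hb : b.π i = i) (hy : y.π i = i) (hbs : b.s i = -1) (hys : y.s i = -1) : y.v i = b.v i := by
  have h1 := congrArg (fun z => v z i) h.eq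
  have hb' : b.π⁻¹ i = i := by rw [Equiv.Perm.inv_eq_iff_eq, hb]
  have hy' : y.π⁻¹ i = i := by rw [Equiv.Perm.inv_eq_iff_eq, hy]
  simp only [mul_v, hb', hy', hbs, hys] at h1
  push_cast at h1
  omega

lemma exists_kind_of_kindCount_pos {a : AffineWeylC n} {c : PointKind} (h : 0 < kindCount a c) :
    ∃ i, kind a i = c :=
  Set.nonempty_of_ncard_ne_zero h.ne'

lemma eq_of_kindCount_eq_one {a : AffineWeylC n} {c : PointKind} (h : kindCount a c = 1)
    {i j : Fin n} (hi : kind a i = c) (hj : kind a j = c) : i = j := by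
  obtain ⟨x, hx⟩ := Set.ncard_eq_one.1 h
  have h1 : i ∈ {i | kind a i = c} := hi
  have h2 : j ∈ {i | kind a i = c} := hj
  rw [hx] at h1 h2
  exact h1.trans h2.symm

lemma eq_of_kindCount_eq_two {a : AffineWeylC n} {c : PointKind} (h : kindCount a c = 2)
    {i j k : Fin n} (hi : kind a i = c) (hj : kind a j = c) (hk : kind a k = c) (hij : i ≠ j)
    (hik : k ≠ i) : k = j := by
  obtain ⟨x, y, -, hx⟩ := Set.ncard_eq_two.1 h
  have h1 : i ∈ {i | kind a i = c} := hi
  have h2 : j ∈ {i | kind a i = c} := hj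
  have h3 : k ∈ {i | kind a i = c} := hk
  rw [hx] at h1 h2 h3
  simp only [Set.mem_insert_iff, Set.mem_singleton_iff] at h1 h2 h3
  grind

/-! ### Disconnected classes -/

/-- A property of elements of a conjugacy class that is preserved by commuting and that is
violated by some conjugate of `a` shows that the commuting involution graph is disconnected. -/
lemma not_connected_of_invariant {a : AffineWeylC n} (p : AffineWeylC n → Prop) (ha : p a)
    (step : ∀ b ∈ conjClass a, ∀ y ∈ conjClass a, p b → Commute b y → p y)
    (g : AffineWeylC n) (hg : ¬ p (g * a * g⁻¹)) : ¬ (commGraph (conjClass a)).Connected := by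
  intro hc
  have ha' : a ∈ conjClass a := IsConj.refl a
  have hg' : g * a * g⁻¹ ∈ conjClass a := isConj_iff.2 ⟨g, rfl⟩
  obtain ⟨w⟩ := hc.preconnected ⟨a, ha'⟩ ⟨_, hg'⟩
  have key : ∀ x y : conjClass a, (commGraph (conjClass a)).Walk x y → p x → p y := by
    intro x y w
    induction w with
    | nil => exact id
    | cons h _ ih => exact fun hp => ih (step _ (Subtype.property _) _ (Subtype.property _) hp h.2)
  exact hg (key _ _ w ha)

/-- The translation by the integer `t` in direction `i`. -/
def translation (i : Fin n) (t : ℤ) : AffineWeylC n := ⟨1, 1, Pi.single i t⟩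

lemma conj_translation_v {a : AffineWeylC n} {i : Fin n} (hi : a.π i = i) (hs : a.s i = -1)
    (t : ℤ) : (translation i t * a * (translation i t)⁻¹).v i = a.v i - 2 * t := by
  have hi' : a.π⁻¹ i = i := by rw [Equiv.Perm.inv_eq_iff_eq, hi]
  rw [conj_v]
  simp [translation, hi', hs]
  ring

lemma not_connected_of_all_neg {a : AffineWeylC n} (hn : 2 ≤ n) (h0 : kindCount a .moved = 0)
    (h3 : kindCount a .pos = 0) : ¬ (commGraph (conjClass a)).Connected := by
  have hall : ∀ b ∈ conjClass a, ∀ i, b.π i = i ∧ b.s i = -1 := by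
    intro b hb i
    rw [← kindCount_of_mem_conjClass hb, kindCount, Set.ncard_eq_zero] at h0 h3
    have h0' : kind b i ≠ .moved := fun h => Set.eq_empty_iff_forall_notMem.1 h0 i h
    have h3' : kind b i ≠ .pos := fun h => Set.eq_empty_iff_forall_notMem.1 h3 i h
    rw [Ne, kind_eq_moved_iff, not_not] at h0'
    rw [Ne, kind_eq_pos_iff] at h3'
    rcases Int.units_eq_one_or (b.s i) with e | e
    · exact absurd ⟨h0', e⟩ h3'
    · exact ⟨h0', e⟩
  have i : Fin n := ⟨0, by omega⟩
  refine not_connected_of_invariant (fun b => b.v i = a.v i) rfl ?_ (translation i 1) ?_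
  · intro b hb y hy hp hc
    rw [← hp]
    exact v_eq_of_commute hc (hall b hb i).1 (hall y hy i).1 (hall b hb i).2 (hall y hy i).2
  · have := hall a (IsConj.refl a) i
    simp only [conj_translation_v this.1 this.2]
    omega

lemma not_connected_of_unique_neg {a : AffineWeylC n} {c : PointKind}
    (hc : c = .negEven ∨ c = .negOdd) (h3 : kindCount a .pos = 0) (h1 : kindCount a c = 1) :
    ¬ (commGraph (conjClass a)).Connected := by
  obtain ⟨i, hi⟩ := exists_kind_of_kindCount_pos (h1 ▸ Nat.one_pos)
  have hia : a.π i = i ∧ a.s i = -1 := by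
    rcases hc with rfl | rfl
    · rw [kind_eq_negEven_iff] at hi; exact ⟨hi.1, hi.2.1⟩
    · rw [kind_eq_negOdd_iff] at hi; exact ⟨hi.1, hi.2.1⟩
  refine not_connected_of_invariant (fun b => b.π i = i ∧ b.s i = -1 ∧ b.v i = a.v i)
    ⟨hia.1, hia.2, rfl⟩ ?_ (translation i 1) ?_
  · rintro b hb y hy ⟨hp1, hp2, hp3⟩ hcomm
    have hib : kind b i = c := by
      rcases hc with rfl | rfl
      · rw [kind_eq_negEven_iff] at hi ⊢; exact ⟨hp1, hp2, hp3 ▸ hi.2.2⟩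
      · rw [kind_eq_negOdd_iff] at hi ⊢; exact ⟨hp1, hp2, hp3 ▸ hi.2.2⟩
    have hyi : y.π i = i := by
      refine eq_of_kindCount_eq_one ((kindCount_of_mem_conjClass hb c).trans h1) ?_ hib
      rw [kind_apply_of_commute hcomm, hib]
    have hys : y.s i = -1 := by
      refine (Int.units_eq_one_or _).resolve_left fun e => ?_
      rw [← kindCount_of_mem_conjClass hy, kindCount, Set.ncard_eq_zero] at h3
      exact Set.eq_empty_iff_forall_notMem.1 h3 i ((kind_eq_pos_iff _ _).2 ⟨hyi, e⟩)
    exact ⟨hyi, hys, (v_eq_of_commute hcomm hp1 hyi hp2 hys).trans hp3⟩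
  · rintro ⟨-, -, h⟩
    rw [conj_translation_v hia.1 hia.2] at h
    omega

/-- The signed permutation with trivial signs and labels and underlying permutation `p`. -/
def ofPerm (p : Equiv.Perm (Fin n)) : AffineWeylC n := ⟨p, 1, 0⟩

lemma kind_conj_swap_right (a : AffineWeylC n) (i j : Fin n) :
    kind (ofPerm (Equiv.swap i j) * a * (ofPerm (Equiv.swap i j))⁻¹) j = kind a i := by
  rw [kind_conj]; simp [ofPerm]

lemma kind_conj_swap_of_ne (a : AffineWeylC n) {i j k : Fin n} (hi : k ≠ i) (hj : k ≠ j) :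
    kind (ofPerm (Equiv.swap i j) * a * (ofPerm (Equiv.swap i j))⁻¹) k = kind a k := by
  rw [kind_conj]; simp [ofPerm, Equiv.swap_apply_of_ne_of_ne hi hj]

lemma ncard_moved_add_ncard_fixed (b : AffineWeylC n) :
    kindCount b .moved + {i | b.π i = i}.ncard = n := by
  have h := Set.ncard_add_ncard_compl {i | b.π i = i}
  have : {i | b.π i = i}ᶜ = {i | kind b i = .moved} := by
    ext i; simp [kind_eq_moved_iff]
  rw [this, Nat.card_fin] at h
  rw [kindCount]; omega

lemma not_connected_of_distinct_fixed_kinds {a : AffineWeylC n} (h0 : 0 < kindCount a .moved)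
    (h : ∀ c ≠ .moved, kindCount a c ≤ 1) (h3 : 0 < kindCount a .pos) :
    ¬ (commGraph (conjClass a)).Connected := by
  obtain ⟨i, hi⟩ := exists_kind_of_kindCount_pos h0
  obtain ⟨j, hj⟩ := exists_kind_of_kindCount_pos h3
  refine not_connected_of_invariant (fun b => {i | b.π i = i} = {i | a.π i = i}) rfl ?_
    (ofPerm (Equiv.swap j i)) ?_
  · intro b hb y hy hp hcomm
    rw [← hp]
    symm
    refine Set.eq_of_subset_of_ncard_le ?_ ?_
    · intro k hk
      have hk' : kind b k ≠ .moved := by rw [Ne, kind_eq_moved_iff, not_not]; exact hk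
      have h1 := h _ hk'
      rw [← kindCount_of_mem_conjClass hb] at h1
      exact (Set.ncard_le_one (Set.toFinite _)).1 h1 _ (kind_apply_of_commute hcomm k) _ rfl
    · have h1 := ncard_moved_add_ncard_fixed b
      have h2 := ncard_moved_add_ncard_fixed y
      rw [kindCount_of_mem_conjClass hb] at h1
      rw [kindCount_of_mem_conjClass hy] at h2
      omega
  · intro hp
    have h1 := kind_conj_swap_right a j i
    rw [hj, kind_eq_pos_iff] at h1
    have h2 : i ∈ {i | a.π i = i} := hp ▸ h1.1
    exact (kind_eq_moved_iff _ _).1 hi h2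

lemma exists_ne_of_two_le_kindCount {a : AffineWeylC n} {c : PointKind} (h : 2 ≤ kindCount a c)
    (i : Fin n) : ∃ j, kind a j = c ∧ j ≠ i :=
  Set.exists_ne_of_one_lt_ncard h i

lemma not_connected_of_four {a : AffineWeylC n} (hn : n = 4) (h0 : kindCount a .moved = 2) :
    ¬ (commGraph (conjClass a)).Connected := by
  obtain ⟨i, hi⟩ := exists_kind_of_kindCount_pos (h0 ▸ Nat.two_pos)
  obtain ⟨j, hj, hji⟩ := exists_ne_of_two_le_kindCount h0.ge i
  have h0' := ncard_moved_add_ncard_fixed a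
  obtain ⟨k, hk⟩ := Set.nonempty_of_ncard_ne_zero (s := {i | a.π i = i}) (by omega)
  have hk' : kind a k ≠ .moved := by rw [Ne, kind_eq_moved_iff, not_not]; exact hk
  have hstep : ∀ b ∈ conjClass a, ∀ i j, i ≠ j → (b.π i = i ↔ b.π j = j) → ∀ y, Commute b y →
      y.π i ≠ i → y.π j ≠ j := by
    intro b hb i j hij hp y hcomm hyi
    suffices y.π i = j by
      rw [← this]; exact fun e => hyi (y.π.injective e)
    have hkind := kind_apply_of_commute hcomm i
    have hcard := ncard_moved_add_ncard_fixed b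
    rw [kindCount_of_mem_conjClass hb, h0] at hcard
    by_cases hbi : b.π i = i
    · have h2 : {i | b.π i = i}.ncard = 2 := by omega
      have hyb : b.π (y.π i) = y.π i := by
        have : kind b i ≠ .moved := by rw [Ne, kind_eq_moved_iff, not_not]; exact hbi
        rwa [← hkind, Ne, kind_eq_moved_iff, not_not] at this
      obtain ⟨x, z, -, hx⟩ := Set.ncard_eq_two.1 h2
      have h1 : i ∈ {i | b.π i = i} := hbi
      have h2 : j ∈ {i | b.π i = i} := hp.1 hbi
      have h3 : y.π i ∈ {i | b.π i = i} := hyb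
      rw [hx] at h1 h2 h3
      simp only [Set.mem_insert_iff, Set.mem_singleton_iff] at h1 h2 h3
      grind
    · have hbi' := (kind_eq_moved_iff _ _).2 hbi
      refine eq_of_kindCount_eq_two ((kindCount_of_mem_conjClass hb _).trans h0) hbi' ?_
        (hkind.trans hbi') hij hyi
      exact (kind_eq_moved_iff _ _).2 fun e => hbi (hp.2 e)
  refine not_connected_of_invariant (fun b => b.π i = i ↔ b.π j = j) ?_ ?_
    (ofPerm (Equiv.swap k j)) ?_
  · rw [kind_eq_moved_iff] at hi hj
    simp [hi, hj]
  · intro b hb y hy hp hcomm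
    have h1 := hstep b hb i j hji.symm hp y hcomm
    have h2 := hstep b hb j i hji hp.symm y hcomm
    tauto
  · intro hp
    have h1 := kind_conj_swap_right a k j
    have h2 := kind_conj_swap_of_ne a (i := k) (j := j) (k := i) (by rintro rfl; exact hk' hi)
      hji.symm
    rw [hi, kind_eq_moved_iff] at h2
    rw [← h1, Ne, kind_eq_moved_iff] at hk'
    tauto

lemma not_connected_of_three_pairs {a : AffineWeylC n} (h0 : kindCount a .moved = 2)
    (h1 : kindCount a .negEven = 2) (h2 : kindCount a .negOdd = 2) (h3 : kindCount a .pos = 0) :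
    ¬ (commGraph (conjClass a)).Connected := by
  have hpos : ∀ b ∈ conjClass a, ∀ i, kind b i ≠ .pos := by
    intro b hb i hi
    rw [← kindCount_of_mem_conjClass hb, kindCount, Set.ncard_eq_zero] at h3
    exact Set.eq_empty_iff_forall_notMem.1 h3 i hi
  have htwo : ∀ b ∈ conjClass a, ∀ i, kindCount b (kind b i) = 2 := by
    intro b hb i
    rw [kindCount_of_mem_conjClass hb]
    have := hpos b hb i
    cases h : kind b i <;> simp_all
  obtain ⟨i, hi⟩ := exists_kind_of_kindCount_pos (h0 ▸ Nat.two_pos)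
  obtain ⟨j, hj, hji⟩ := exists_ne_of_two_le_kindCount h0.ge i
  obtain ⟨k, hk⟩ := exists_kind_of_kindCount_pos (h1 ▸ Nat.two_pos)
  have hstep : ∀ b ∈ conjClass a, ∀ i j, i ≠ j → kind b i = kind b j → ∀ y, Commute b y →
      y.π i ≠ i → y.π i = j := by
    intro b hb i j hij hp y hcomm hyi
    exact eq_of_kindCount_eq_two (htwo b hb i) rfl hp.symm (kind_apply_of_commute hcomm i) hij hyi
  refine not_connected_of_invariant (fun b => kind b i = kind b j) (hi.trans hj.symm) ?_
    (ofPerm (Equiv.swap k j)) ?_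
  · intro b hb y hy hp hcomm
    by_cases hyi : y.π i = i
    swap
    · have := hstep b hb i j hji.symm hp y hcomm hyi
      rw [← this, (kind_eq_moved_iff _ _).2 hyi, eq_comm, kind_eq_moved_iff]
      exact fun e => hyi (y.π.injective e)
    by_cases hyj : y.π j = j
    swap
    · have := hstep b hb j i hji hp.symm y hcomm hyj
      rw [← this, (kind_eq_moved_iff _ _).2 hyj, kind_eq_moved_iff]
      exact fun e => hyj (y.π.injective e)
    by_cases hbi : b.π i = i
    · have hbj : b.π j = j := by
        by_contra e
        rw [← Ne, ← kind_eq_moved_iff, ← hp, kind_eq_moved_iff] at e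
        exact e hbi
      have hneg : ∀ z ∈ conjClass a, ∀ k, z.π k = k → z.s k = -1 := fun z hz k hk =>
        (Int.units_eq_one_or _).resolve_left fun e => hpos z hz k ((kind_eq_pos_iff _ _).2 ⟨hk, e⟩)
      have hkind : ∀ k, b.π k = k → y.π k = k → kind y k = kind b k := by
        intro k hbk hyk
        have e1 := hneg b hb k hbk
        have e2 := hneg y hy k hyk
        have e3 := v_eq_of_commute hcomm hbk hyk e1 e2
        unfold kind
        rw [e1, e2, e3, hbk, hyk]
      rw [hkind i hbi hyi, hkind j hbj hyj, hp]
    · have hb' : b.π i = j := eq_of_kindCount_eq_two ((kindCount_of_mem_conjClass hb .moved).trans h0)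
        ((kind_eq_moved_iff _ _).2 hbi) (hp ▸ (kind_eq_moved_iff _ _).2 hbi)
        ((kind_eq_moved_iff _ _).2 fun e => hbi (b.π.injective e)) hji.symm hbi
      rw [← hb', kind_apply_of_commute hcomm.symm]
  · have e1 := kind_conj_swap_right a k j
    have e2 := kind_conj_swap_of_ne a (i := k) (j := j) (k := i)
      (by rintro rfl; rw [hi] at hk; exact absurd hk (by simp)) hji.symm
    rw [e1, e2, hi, hk]
    simp

/-! ### Connected classes -/

/-- The subgroup generated by the elements that conjugate `a` to something commuting with `a`. -/
def linkSubgroup (a : AffineWeylC n) : Subgroup (AffineWeylC n) :=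
  Subgroup.closure {g | Commute a (g * a * g⁻¹)}

lemma mem_linkSubgroup {a g : AffineWeylC n} (h : Commute a (g * a * g⁻¹)) :
    g ∈ linkSubgroup a :=
  Subgroup.subset_closure h

/-- Conjugation by `g` as an endomorphism of the commuting involution graph. -/
def conjHom (a g : AffineWeylC n) : commGraph (conjClass a) →g commGraph (conjClass a) where
  toFun x := ⟨g * x * g⁻¹, IsConj.trans x.2 (isConj_iff.2 ⟨g, rfl⟩)⟩
  map_rel' {x y} h := by
    refine ⟨fun e => h.1 (by simpa using e), ?_⟩
    simpa using h.2.map (MulAut.conj g)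

lemma reachable_of_mem_linkSubgroup {a g : AffineWeylC n} (hg : g ∈ linkSubgroup a) :
    (commGraph (conjClass a)).Reachable ⟨a, IsConj.refl a⟩
      ⟨g * a * g⁻¹, isConj_iff.2 ⟨g, rfl⟩⟩ := by
  induction hg using Subgroup.closure_induction with
  | mem g hg =>
    by_cases h : a = g * a * g⁻¹
    · simp only [← h]; exact SimpleGraph.Reachable.refl _
    · exact SimpleGraph.Adj.reachable ⟨h, hg⟩
  | one => simp only [one_mul, inv_one, mul_one]; exact SimpleGraph.Reachable.refl _
  | mul g h _ _ ihg ihh =>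
    refine ihg.trans ?_
    convert ihh.map (conjHom a g) using 2 <;>
      exact Subtype.ext (by simp [conjHom, mul_assoc])
  | inv g _ ih =>
    have := (ih.map (conjHom a g⁻¹)).symm
    convert this using 2 <;> exact Subtype.ext (by simp [conjHom, mul_assoc])

lemma connected_of_linkSubgroup_eq_top {a : AffineWeylC n} (h : linkSubgroup a = ⊤) :
    (commGraph (conjClass a)).Connected := by
  rw [SimpleGraph.connected_iff_exists_forall_reachable]
  refine ⟨⟨a, IsConj.refl a⟩, ?_⟩
  rintro ⟨b, hb⟩
  obtain ⟨g, rfl⟩ := isConj_iff.1 hb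
  exact reachable_of_mem_linkSubgroup (h ▸ Subgroup.mem_top g)

lemma ofPerm_mul (p q : Equiv.Perm (Fin n)) : ofPerm (p * q) = ofPerm q * ofPerm p := by
  ext <;> simp [ofPerm]

lemma ofPerm_one : ofPerm (1 : Equiv.Perm (Fin n)) = 1 := rfl

lemma ofPerm_inv (p : Equiv.Perm (Fin n)) : ofPerm p⁻¹ = (ofPerm p)⁻¹ := by
  rw [eq_inv_iff_mul_eq_one, ← ofPerm_mul, mul_inv_cancel, ofPerm_one]

lemma negOne_conj_swap (i j : Fin n) (t : ℤ) :
    ofPerm (Equiv.swap i j) * negOne i t * (ofPerm (Equiv.swap i j))⁻¹ = negOne j t := by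
  have h : ∀ k, Equiv.swap i j k = i ↔ k = j := by
    intro k; rw [← Equiv.eq_symm_apply]; simp
  ext k
  · simp [ofPerm, negOne]
  · simp [ofPerm, negOne, h]
  · rw [conj_v]; simp [ofPerm, negOne, h]

/-- The swaps together with the labelled negative 1-cycles at one point generate `G_n`. -/
lemma subgroup_eq_top_of_generators {H : Subgroup (AffineWeylC n)} (i₀ : Fin n)
    (hswap : ∀ i, ofPerm (Equiv.swap i i₀) ∈ H) (hneg : ∀ t, negOne i₀ t ∈ H) : H = ⊤ := by
  have hneg' : ∀ i t, negOne i t ∈ H := by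
    intro i t
    rw [← negOne_conj_swap i₀ i t, Equiv.swap_comm]
    exact H.mul_mem (H.mul_mem (hswap i) (hneg t)) (H.inv_mem (hswap i))
  have hswap' : ∀ i j, ofPerm (Equiv.swap i j) ∈ H := by
    intro i j
    exact SubmonoidClass.swap_mem_trans (M := H.toSubmonoid.op.comap
      (MonoidHom.mk' (fun p => MulOpposite.op (ofPerm p)) fun p q => by
        rw [ofPerm_mul, MulOpposite.op_mul])) (hswap i) (by
          rw [Equiv.swap_comm]; exact hswap j)
  have hperm : ∀ p, ofPerm p ∈ H := by
    intro p
    induction p using Equiv.Perm.swap_induction_on with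
    | one => exact H.one_mem
    | swap_mul f x y _ ih => rw [ofPerm_mul]; exact H.mul_mem ih (hswap' x y)
  have hlocal : ∀ (i : Fin n) (e : ℤˣ) (t : ℤ),
      (⟨1, fun k => if k = i then e else 1, fun k => if k = i then t else 0⟩ : AffineWeylC n)
        ∈ H := by
    intro i e t
    rcases Int.units_eq_one_or e with rfl | rfl
    · convert H.mul_mem (hneg' i 0) (hneg' i t) using 1
      ext k
      · simp [negOne]
      · by_cases h : k = i <;> simp [negOne, h]
      · by_cases h : k = i <;> simp [negOne, h]
    · exact hneg' i t
  have hdiag : ∀ (s : Fin n → ℤˣ) (v : Fin n → ℤ) (S : Finset (Fin n)),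
      (⟨1, fun k => if k ∈ S then s k else 1, fun k => if k ∈ S then v k else 0⟩ : AffineWeylC n)
        ∈ H := by
    intro s v S
    induction S using Finset.induction_on with
    | empty => exact H.one_mem
    | insert i S hi ih =>
      convert H.mul_mem ih (hlocal i (s i) (v i)) using 1
      ext k
      · simp
      · by_cases h : k = i
        · subst h; simp [hi]
        · simp [h]
      · by_cases h : k = i
        · subst h; simp [hi]
        · simp [h]
  rw [eq_top_iff]
  intro g _
  have h := H.mul_mem (hdiag g.s (g.v ∘ g.π) Finset.univ) (hperm g.π)
  convert h using 1
  ext k <;> simp [ofPerm]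

/-- An involution is normalized if its 2-cycles are positive with label `0` and its negative
1-cycles have labels `0` or `1`. -/
structure IsNormalized (a : AffineWeylC n) : Prop where
  involutive : ∀ i, a.π (a.π i) = i
  moved : ∀ i, kind a i = .moved → a.s i = 1 ∧ a.v i = 0
  negEven : ∀ i, kind a i = .negEven → a.s i = -1 ∧ a.v i = 0
  negOdd : ∀ i, kind a i = .negOdd → a.s i = -1 ∧ a.v i = 1
  pos : ∀ i, kind a i = .pos → a.s i = 1 ∧ a.v i = 0

lemma π_involutive {a : AffineWeylC n} (h : a * a = 1) (i : Fin n) : a.π (a.π i) = i :=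
  congrArg (fun z => z.π i) h

/-- Every involution is conjugate to a normalized one. -/
lemma exists_conj_isNormalized {a : AffineWeylC n} (h : a * a = 1) :
    ∃ g, IsNormalized (g * a * g⁻¹) := by
  have hinv := π_involutive h
  have hinv' : ∀ i, a.π⁻¹ i = a.π i := fun i => by rw [Equiv.Perm.inv_eq_iff_eq, hinv]
  have hs : ∀ i, a.s (a.π i) = a.s i := by
    intro i
    have := congrArg (fun z => s z i) h
    simp only [mul_s, one_s] at this
    rw [mul_eq_one_iff_inv_eq] at this
    simpa using this.symm
  have hv : ∀ i, a.s (a.π i) * a.v (a.π i) + a.v i = 0 := by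
    intro i
    have := congrArg (fun z => v z i) h
    simpa [hinv'] using this
  let g : AffineWeylC n := ⟨1, fun i => if a.π i < i then a.s i else 1, fun i =>
    if a.π i < i then - a.s i * a.v (a.π i) else if a.s i = -1 ∧ a.π i = i then a.v i / 2 else 0⟩
  have e1 : ∀ i, (g * a * g⁻¹).s i = g.s i * a.s i * g.s (a.π i) := by
    intro i; rw [conj_s]; simp [g]
  have e2 : ∀ i, (g * a * g⁻¹).v i = g.s i * (a.s i * g.v (a.π i) + a.v i - g.v i) := by
    intro i
    rw [conj_v]
    show (g.s i : ℤ) * (a.s (a.π⁻¹ i) * g.v (a.π⁻¹ i) + a.v i - g.v i) = _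
    rw [hinv', hs]
  have hk : ∀ i, kind (g * a * g⁻¹) i = kind a i := fun i => kind_conj g a i
  have hfix : ∀ i, a.π i = i → (g * a * g⁻¹).s i = a.s i ∧
      (g * a * g⁻¹).v i = a.s i * g.v i + a.v i - g.v i := by
    intro i hi
    rw [e1, e2, hi]
    simp [g, hi]
  refine ⟨g, ?_, ?_, ?_, ?_, ?_⟩
  · intro i
    show (g * a * g⁻¹).π ((g * a * g⁻¹).π i) = i
    simp [g, hinv]
  · intro i hi
    rw [hk, kind_eq_moved_iff] at hi
    have hvi := hv i
    rw [e1, e2]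
    rcases lt_or_gt_of_ne hi with h' | h'
    · have h2 : ¬ i < a.π i := h'.le.not_gt
      rw [hs] at hvi
      rcases Int.units_eq_one_or (a.s i) with e | e <;> simp [g, h', hinv, h2, e] at hvi ⊢ <;>
        omega
    · have h2 : ¬ a.π i < i := h'.le.not_gt
      rcases Int.units_eq_one_or (a.s i) with e | e <;> simp [g, h', hinv, h2, e, hi, hs]
  · intro i hi
    rw [hk, kind_eq_negEven_iff] at hi
    obtain ⟨f1, f2⟩ := hfix i hi.1
    obtain ⟨k, hk⟩ := hi.2.2
    rw [f1, f2]
    simp [g, hi.1, hi.2.1]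
    omega
  · intro i hi
    rw [hk, kind_eq_negOdd_iff] at hi
    obtain ⟨f1, f2⟩ := hfix i hi.1
    obtain ⟨k, hk⟩ := hi.2.2
    rw [f1, f2]
    simp [g, hi.1, hi.2.1]
    omega
  · intro i hi
    rw [hk, kind_eq_pos_iff] at hi
    obtain ⟨f1, f2⟩ := hfix i hi.1
    rw [f1, f2]
    have := hv i
    simp [hi.1, hi.2] at this
    simp [g, hi.1, hi.2]
    omega

lemma kind_π (a : AffineWeylC n) (i : Fin n) : kind a (a.π i) = kind a i := by
  by_cases h : a.π i = i
  · rw [h]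
  · rw [(kind_eq_moved_iff _ _).2 h, kind_eq_moved_iff]
    exact fun e => h (a.π.injective e)

namespace IsNormalized

variable {a : AffineWeylC n}

lemma π_inv (ha : IsNormalized a) (i : Fin n) : a.π⁻¹ i = a.π i := by
  rw [Equiv.Perm.inv_eq_iff_eq, ha.involutive]

lemma eq_of_kind_eq (ha : IsNormalized a) {i j : Fin n} (h : kind a i = kind a j) :
    a.s i = a.s j ∧ a.v i = a.v j := by
  have h1 := ha.moved
  have h2 := ha.negEven
  have h3 := ha.negOdd
  have h4 := ha.pos
  cases hj : kind a j <;> grind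

lemma v_eq_zero (ha : IsNormalized a) {i : Fin n} (h : a.s i = 1) : a.v i = 0 := by
  cases hi : kind a i
  · exact (ha.moved i hi).2
  · exact (ha.negEven i hi).2
  · have := (ha.negOdd i hi).1
    rw [h] at this
    exact absurd this (by decide)
  · exact (ha.pos i hi).2

/-- A criterion for an involutive permutation to lie in the subgroup `linkSubgroup a`. -/
lemma ofPerm_mem (ha : IsNormalized a) {p : Equiv.Perm (Fin n)} (hp : ∀ x, p (p x) = x)
    (hcomm : ∀ x, a.π (p (a.π (p x))) = p (a.π (p (a.π x))))
    (hkind : ∀ x, kind a (p (a.π (p x))) = kind a x)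
    (hlabel : ∀ x, a.s x = 1 ∨ a.s (p x) = 1 ∨ a.v x = a.v (p x)) :
    ofPerm p ∈ linkSubgroup a := by
  apply mem_linkSubgroup
  have hp' : ∀ x, p⁻¹ x = p x := fun x => by rw [Equiv.Perm.inv_eq_iff_eq, hp]
  set b := ofPerm p * a * (ofPerm p)⁻¹ with hb
  have bπ : ∀ x, b.π x = p (a.π (p x)) := fun x => hp' _
  have bπ' : ∀ x, b.π⁻¹ x = p (a.π (p x)) := fun x => by
    rw [Equiv.Perm.inv_eq_iff_eq, bπ, hp, ha.involutive, hp]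
  have bs : ∀ x, b.s x = a.s (p x) := fun x => by rw [hb, conj_s]; simp [ofPerm]
  have bv : ∀ x, b.v x = a.v (p x) := fun x => by rw [hb, conj_v]; simp [ofPerm]
  have k1 := fun x => ha.eq_of_kind_eq (hkind x)
  have k2 : ∀ x, a.s (p (a.π x)) = a.s (p x) ∧ a.v (p (a.π x)) = a.v (p x) := fun x => by
    simpa only [hp] using k1 (p x)
  have k3 := fun x => ha.eq_of_kind_eq (kind_π a x)
  refine AffineWeylC.ext (Equiv.ext fun x => ?_) (funext fun x => ?_) (funext fun x => ?_)
  · simp only [mul_π, Equiv.Perm.mul_apply, bπ]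
    exact (hcomm x).symm
  · simp only [mul_s, bs, bπ, (k1 _).1, (k2 _).1, mul_comm]
  · simp only [mul_v, bs, bv, bπ', ha.π_inv, hp, (k1 _).2, (k2 _).2, (k3 _).1]
    rcases hlabel x with e | e | e
    · simp [e, ha.v_eq_zero e]
    · simp [e, ha.v_eq_zero e]
    · rcases Int.units_eq_one_or (a.s x) with e1 | e1 <;>
      rcases Int.units_eq_one_or (a.s (p x)) with e2 | e2 <;> simp [e1, e2, e] <;>
      · first
        | have := ha.v_eq_zero e1
          omega
        | have := ha.v_eq_zero e2
          omega

lemma swap_mem_of_kind_eq (ha : IsNormalized a) {i j : Fin n} (h : kind a i = kind a j) :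
    ofPerm (Equiv.swap i j) ∈ linkSubgroup a := by
  have hinv := ha.involutive
  have hmov := kind_eq_moved_iff a
  have hk := kind_π a
  refine ha.ofPerm_mem (Equiv.swap_apply_self i j) ?_ ?_ ?_
  · intro x
    grind
  · intro x
    grind
  · intro x
    refine .inr (.inr (ha.eq_of_kind_eq ?_).2)
    grind

lemma swap_mem_of_pos (ha : IsNormalized a) {i j : Fin n} (hi : kind a i ≠ .moved)
    (hj : kind a j = .pos) : ofPerm (Equiv.swap i j) ∈ linkSubgroup a := by
  rw [Ne, kind_eq_moved_iff, not_not] at hi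
  have hj' := (kind_eq_pos_iff _ _).1 hj
  have hinv := ha.involutive
  refine ha.ofPerm_mem (Equiv.swap_apply_self i j) ?_ ?_ ?_
  · intro x
    grind
  · intro x
    rw [← kind_π a x]
    grind
  · intro x
    grind

/-- Exchanging a 2-cycle with two 1-cycles of the same kind. -/
lemma swap_mul_swap_mem (ha : IsNormalized a) {i k l : Fin n} (hi : kind a i = .moved)
    (hk : kind a k ≠ .moved) (hkl : kind a k = kind a l) (hne : k ≠ l) :
    ofPerm (Equiv.swap i k * Equiv.swap (a.π i) l) ∈ linkSubgroup a := by
  have hinv := ha.involutive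
  have hkπ := kind_π a
  have hil : kind a l ≠ .moved := hkl ▸ hk
  have hmov := kind_eq_moved_iff a
  have hi1 := (ha.moved i hi).1
  have hi2 := (ha.moved (a.π i) ((kind_π a i).trans hi)).1
  have hi' := (hmov i).1 hi
  have hk' : a.π k = k := by by_contra e; exact hk ((hmov k).2 e)
  have hl' : a.π l = l := by by_contra e; exact hil ((hmov l).2 e)
  have h1 : i ≠ k := by rintro rfl; exact hk hi
  have h2 : i ≠ l := by rintro rfl; exact hil hi
  have h3 : a.π i ≠ k := fun e => h1 (a.π.injective (e.trans hk'.symm))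
  have h4 : a.π i ≠ l := fun e => h2 (a.π.injective (e.trans hl'.symm))
  set j := a.π i with hj
  have hj' : a.π j = i := hinv i
  have hp : ∀ x, (Equiv.swap i k * Equiv.swap j l) x =
      if x = i then k else if x = k then i else if x = j then l else if x = l then j else x := by
    intro x
    rw [Equiv.Perm.mul_apply]
    grind
  refine ha.ofPerm_mem ?_ ?_ ?_ ?_
  · intro x
    simp only [hp]
    grind
  · intro x
    simp only [hp]
    grind
  · intro x
    simp only [hp]
    grind
  · intro x
    simp only [hp]
    grind

lemma negOne_mem (ha : IsNormalized a) {i : Fin n} (hi : kind a i = .moved ∨ kind a i = .pos)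
    (t : ℤ) : negOne i t ∈ linkSubgroup a := by
  apply mem_linkSubgroup
  have k3 := fun x => ha.eq_of_kind_eq (kind_π a x)
  set b := negOne i t * a * (negOne i t)⁻¹ with hb
  have bπ : b.π = a.π := by ext x; simp [hb, negOne]
  have bs : ∀ x, b.s x = (negOne i t).s x * a.s x * (negOne i t).s (a.π x) := fun x => by
    rw [hb, conj_s]; simp [negOne]
  have bv : ∀ x, b.v x = (negOne i t).s x *
      (a.s x * (negOne i t).v (a.π x) + a.v x - (negOne i t).v x) := fun x => by
    rw [hb, conj_v]; simp [negOne, ha.π_inv, (k3 _).1]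
  refine AffineWeylC.ext (by simp [bπ]) (funext fun x => ?_) (funext fun x => ?_)
  · simp only [mul_s, bs, bπ, (k3 _).1, ha.involutive]
    ac_rfl
  · simp only [mul_v, bπ, ha.π_inv, (k3 _).1, (k3 _).2]
    simp only [bs, bv, (k3 _).1, (k3 _).2, ha.involutive]
    rcases hi with hi | hi
    · have hi' := (kind_eq_moved_iff _ _).1 hi
      obtain ⟨s1, v1⟩ := ha.moved i hi
      by_cases h1 : x = i
      · subst h1
        simp [negOne, hi', s1, v1]
      by_cases h2 : a.π x = i
      · have e := k3 x
        rw [h2] at e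
        simp [negOne, h1, h2, ← e.1, ← e.2, s1, v1]
      · simp [negOne, h1, h2]
    · have hi' := (kind_eq_pos_iff _ _).1 hi
      obtain ⟨s1, v1⟩ := ha.pos i hi
      by_cases h1 : x = i
      · subst h1
        simp [negOne, hi', v1]
      have h2 : a.π x ≠ i := fun e => h1 (a.π.injective (e.trans hi'.1.symm))
      simp [negOne, h1, h2]

end IsNormalized

/-- Two points are linked if the swap exchanging them lies in `linkSubgroup a`. -/
def Linked (a : AffineWeylC n) (i j : Fin n) : Prop :=
  ofPerm (Equiv.swap i j) ∈ linkSubgroup a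

lemma Linked.symm {a : AffineWeylC n} {i j : Fin n} (h : Linked a i j) : Linked a j i := by
  rwa [Linked, Equiv.swap_comm]

lemma linked_apply {a : AffineWeylC n} {p : Equiv.Perm (Fin n)} (hp : ofPerm p ∈ linkSubgroup a)
    {i j : Fin n} (h : Linked a i j) : Linked a (p i) (p j) := by
  rw [Linked, Equiv.swap_apply_apply, ofPerm_mul, ofPerm_mul, ofPerm_inv]
  exact mul_mem (inv_mem hp) (mul_mem h hp)

lemma Linked.trans {a : AffineWeylC n} {i j k : Fin n} (h1 : Linked a i j) (h2 : Linked a j k) :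
    Linked a i k := by
  by_cases hij : i = j
  · exact hij ▸ h2
  by_cases hik : i = k
  · rw [hik, Linked, Equiv.swap_self]
    exact one_mem _
  · have := linked_apply h2 h1
    rwa [Equiv.swap_apply_of_ne_of_ne hij hik, Equiv.swap_apply_left] at this

lemma kindCount_pos_of_kind {a : AffineWeylC n} {i : Fin n} {c : PointKind} (h : kind a i = c) :
    0 < kindCount a c :=
  (Set.ncard_pos).2 ⟨i, h⟩

lemma exists_ne_ne_of_three_le_ncard {s : Set (Fin n)} (h : 3 ≤ s.ncard) (i j : Fin n) :
    ∃ k ∈ s, k ≠ i ∧ k ≠ j := by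
  by_contra! hc
  have hsub : s ⊆ {i, j} := fun k hk => by
    by_cases e : k = i
    · exact .inl e
    · exact .inr (hc k hk e)
  have := Set.ncard_le_ncard hsub
  have := Set.ncard_insert_le i {j}
  rw [Set.ncard_singleton] at this
  omega

namespace IsNormalized

variable {a : AffineWeylC n}

lemma linked_of_kind_eq (ha : IsNormalized a) {i j : Fin n} (h : kind a i = kind a j) :
    Linked a i j :=
  ha.swap_mem_of_kind_eq h

/-- If two points `k`, `l` are of the same kind and outside of the 2-cycles, then a point `r`
different from `d`, `π d`, `k`, `l` that is linked to `k` or `d` links `k` and `d`. -/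
lemma linked_of_linked (ha : IsNormalized a) {d k l r : Fin n} (hd : kind a d = .moved)
    (hk : kind a k ≠ .moved) (hkl : kind a k = kind a l) (hne : k ≠ l) (hrd : r ≠ d)
    (hrd' : r ≠ a.π d) (hrk : r ≠ k) (hrl : r ≠ l) (h : Linked a r k ∨ Linked a r d) :
    Linked a k d := by
  have hmem := ha.swap_mul_swap_mem hd hk hkl hne
  have hl : kind a l ≠ .moved := hkl ▸ hk
  have hd' : kind a (a.π d) = .moved := (kind_π a d).trans hd
  have hdd : a.π d ≠ d := (kind_eq_moved_iff _ _).1 hd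
  have e1 : a.π d ≠ k := fun e => hk (e ▸ hd')
  have e2 : d ≠ k := fun e => hk (e ▸ hd)
  have e3 : d ≠ l := fun e => hl (e ▸ hd)
  have r1 : (Equiv.swap d k * Equiv.swap (a.π d) l) r = r := by
    rw [Equiv.Perm.mul_apply, Equiv.swap_apply_of_ne_of_ne hrd' hrl,
      Equiv.swap_apply_of_ne_of_ne hrd hrk]
  have k1 : (Equiv.swap d k * Equiv.swap (a.π d) l) k = d := by
    rw [Equiv.Perm.mul_apply, Equiv.swap_apply_of_ne_of_ne e1.symm hne, Equiv.swap_apply_right]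
  have d1 : (Equiv.swap d k * Equiv.swap (a.π d) l) d = k := by
    rw [Equiv.Perm.mul_apply, Equiv.swap_apply_of_ne_of_ne hdd.symm e3, Equiv.swap_apply_left]
  rcases h with h | h
  · have := linked_apply hmem h
    rw [r1, k1] at this
    exact h.symm.trans this
  · have := linked_apply hmem h
    rw [r1, d1] at this
    exact this.symm.trans h

lemma connected_of_linked (ha : IsNormalized a) {d : Fin n}
    (hd : kind a d = .moved ∨ kind a d = .pos) (h : ∀ i, Linked a i d) :
    (commGraph (conjClass a)).Connected :=
  connected_of_linkSubgroup_eq_top (subgroup_eq_top_of_generators d h (ha.negOne_mem hd))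

lemma connected_of_moved_eq_zero (ha : IsNormalized a) (h0 : kindCount a .moved = 0)
    (h3 : 0 < kindCount a .pos) : (commGraph (conjClass a)).Connected := by
  obtain ⟨d, hd⟩ := exists_kind_of_kindCount_pos h3
  refine ha.connected_of_linked (.inr hd) fun i => ha.swap_mem_of_pos (fun hi => ?_) hd
  have := kindCount_pos_of_kind hi
  omega

/-- With at least two 2-cycles, a point whose kind occurs twice is linked to the 2-cycles. -/
lemma linked_of_four_le (ha : IsNormalized a) (h4 : 4 ≤ kindCount a .moved) {d k l : Fin n}
    (hd : kind a d = .moved) (hk : kind a k ≠ .moved) (hkl : kind a k = kind a l) (hne : k ≠ l) :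
    Linked a k d := by
  obtain ⟨r, hr, h1, h2⟩ := exists_ne_ne_of_three_le_ncard
    (s := {i | kind a i = .moved}) (by rw [← kindCount]; omega) d (a.π d)
  have hr' : kind a r = .moved := hr
  refine ha.linked_of_linked hd hk hkl hne h1 h2 ?_ ?_
    (.inr (ha.linked_of_kind_eq (hr'.trans hd.symm)))
  · rintro rfl; exact hk hr
  · rintro rfl; exact hk (hkl.trans hr)

/-- A point outside of the 2-cycles linked to a third such point. -/
lemma linked_of_not_moved (ha : IsNormalized a) {d k l r : Fin n}
    (hd : kind a d = .moved) (hk : kind a k ≠ .moved) (hkl : kind a k = kind a l) (hne : k ≠ l)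
    (hr : kind a r ≠ .moved) (hrk : r ≠ k) (hrl : r ≠ l) (h : Linked a r k ∨ Linked a r d) :
    Linked a k d := by
  refine ha.linked_of_linked hd hk hkl hne ?_ ?_ hrk hrl h
  · rintro rfl; exact hr hd
  · rintro rfl; exact hr ((kind_π a d).trans hd)

lemma linked_of_three_le (ha : IsNormalized a) {d k : Fin n} (hd : kind a d = .moved)
    (hk : kind a k ≠ .moved) (h3 : 3 ≤ kindCount a (kind a k)) : Linked a k d := by
  obtain ⟨l, hl, hlk⟩ := exists_ne_of_two_le_kindCount (by omega : 2 ≤ kindCount a (kind a k)) k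
  obtain ⟨r, hr, h1, h2⟩ := exists_ne_ne_of_three_le_ncard h3 k l
  have hr' : kind a r = kind a k := hr
  exact ha.linked_of_not_moved hd hk hl.symm hlk.symm (hr' ▸ hk) h1 h2
    (.inl (ha.linked_of_kind_eq hr'))

lemma connected_of_pos (ha : IsNormalized a) {c : PointKind} (h0 : 2 ≤ kindCount a .moved)
    (h02 : kindCount a .moved = 2 → n ≠ 4) (hc : c ≠ .moved) (h2 : 2 ≤ kindCount a c)
    (h3 : 0 < kindCount a .pos) (heven : kindCount a .moved ≠ 3) :
    (commGraph (conjClass a)).Connected := by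
  obtain ⟨d, hd⟩ := exists_kind_of_kindCount_pos (by omega : 0 < kindCount a .moved)
  obtain ⟨p, hp⟩ := exists_kind_of_kindCount_pos h3
  obtain ⟨k, hk⟩ := exists_kind_of_kindCount_pos (by omega : 0 < kindCount a c)
  obtain ⟨l, hl, hlk⟩ := exists_ne_of_two_le_kindCount h2 k
  have hp' : ∀ i, kind a i ≠ .moved → Linked a i p := fun i hi => ha.swap_mem_of_pos hi hp
  have hkd : Linked a k d := by
    have hkl := hk.trans hl.symm
    have hk' : kind a k ≠ .moved := hk ▸ hc
    by_cases h4 : 4 ≤ kindCount a .moved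
    · exact ha.linked_of_four_le h4 hd hk' hkl hlk.symm
    · have h2' : kindCount a .moved = 2 := by omega
      have hfix := ncard_moved_add_ncard_fixed a
      have h2'' : 2 ≤ {i | a.π i = i}.ncard := by
        refine h2.trans (Set.ncard_le_ncard fun i hi => ?_)
        have hi' : kind a i = c := hi
        rw [← hi', Ne, kind_eq_moved_iff, not_not] at hc
        exact hc
      have := h02 h2'
      obtain ⟨r, hr, h5, h6⟩ := exists_ne_ne_of_three_le_ncard
        (s := {i | a.π i = i}) (by omega) k l
      have hr' : kind a r ≠ .moved := by rw [Ne, kind_eq_moved_iff, not_not]; exact hr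
      exact ha.linked_of_not_moved hd hk' hkl hlk.symm hr' h5 h6
        (.inl ((hp' r hr').trans (hp' k hk').symm))
  refine ha.connected_of_linked (.inl hd) fun i => ?_
  by_cases hi : kind a i = .moved
  · exact ha.linked_of_kind_eq (hi.trans hd.symm)
  · exact ((hp' i hi).trans (hp' k (hk ▸ hc)).symm).trans hkd

lemma connected_of_pos_eq_zero (ha : IsNormalized a) (h0 : 2 ≤ kindCount a .moved)
    (heven : kindCount a .moved ≠ 3) (h1 : kindCount a .negEven ≠ 1)
    (h2 : kindCount a .negOdd ≠ 1) (h3 : kindCount a .pos = 0)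
    (hsmall : kindCount a .moved = 2 → ¬ (kindCount a .negEven ≤ 2 ∧ kindCount a .negOdd ≤ 2 ∧
      0 < kindCount a .negEven + kindCount a .negOdd)) :
    (commGraph (conjClass a)).Connected := by
  obtain ⟨d, hd⟩ := exists_kind_of_kindCount_pos (by omega : 0 < kindCount a .moved)
  refine ha.connected_of_linked (.inl hd) fun k => ?_
  by_cases hk : kind a k = .moved
  · exact ha.linked_of_kind_eq (hk.trans hd.symm)
  have hkc : ∃ c, 2 ≤ kindCount a (kind a k) ∧ c ≠ .moved ∧ (kindCount a .moved = 2 →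
      3 ≤ kindCount a (kind a k) ∨ (3 ≤ kindCount a c ∧ kind a k ≠ c)) := by
    have hpos := kindCount_pos_of_kind (a := a) (i := k) rfl
    cases hkk : kind a k <;> rw [hkk] at hpos
    · exact absurd hkk hk
    · exact ⟨.negOdd, by omega, by simp, by simp; omega⟩
    · exact ⟨.negEven, by omega, by simp, by simp; omega⟩
    · omega
  obtain ⟨c, hk2, hc, hk3⟩ := hkc
  obtain ⟨l, hl, hlk⟩ := exists_ne_of_two_le_kindCount hk2 k
  by_cases h4 : 4 ≤ kindCount a .moved
  · exact ha.linked_of_four_le h4 hd hk hl.symm hlk.symm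
  rcases hk3 (by omega) with h | ⟨h, hne⟩
  · exact ha.linked_of_three_le hd hk h
  · obtain ⟨r, hr⟩ := exists_kind_of_kindCount_pos (by omega : 0 < kindCount a c)
    have hrd : Linked a r d := ha.linked_of_three_le hd (hr ▸ hc) (hr ▸ h)
    refine ha.linked_of_not_moved hd hk hl.symm hlk.symm (hr ▸ hc) ?_ ?_ (.inr hrd)
    · rintro rfl; exact hne hr
    · rintro rfl; exact hne (hl.symm.trans hr)

end IsNormalized

lemma conjClass_conj (g a : AffineWeylC n) : conjClass (g * a * g⁻¹) = conjClass a := by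
  have h : IsConj a (g * a * g⁻¹) := isConj_iff.2 ⟨g, rfl⟩
  ext b
  exact ⟨h.trans, h.symm.trans⟩

end AffineWeylC

open AffineWeylC in
/-- Characterization of disconnectedness of the commuting
involution graph in terms of the labelled cycle type `(m, k_e, k_o, l)`. -/
theorem stmt_1 (n m ke ko l : ℕ) (hn : 2 ≤ n) (a : AffineWeylC n)
    (ha : a.Involution) (htype : a.HasType m ke ko l)
    (hsum : 2 * m + ke + ko + l = n)
    (X : Set (AffineWeylC n)) (hX : X = AffineWeylC.conjClass a) :
    ¬ (commGraph X).Connected ↔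
      ((m = 0 ∧ l = 0) ∨
       (0 < m ∧ l = 0 ∧ (ke = 1 ∨ ko = 1)) ∨
       (0 < m ∧ max (max ke ko) l = 1) ∨
       (n = 4 ∧ m = 1) ∨
       (n = 6 ∧ m = 1 ∧ ke = 2 ∧ ko = 2)) := by
  subst hX
  obtain ⟨h0, h1, h2, h3⟩ := htype.kindCount hsum
  constructor
  · contrapose
    intro hnot
    obtain ⟨g, hg⟩ := exists_conj_isNormalized ha.2
    rw [← conjClass_conj g a]
    rw [← kindCount_conj g] at h0 h1 h2 h3
    by_cases hm : m = 0
    · exact hg.connected_of_moved_eq_zero (by omega) (by omega)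
    by_cases hl : l = 0
    · exact hg.connected_of_pos_eq_zero (by omega) (by omega) (by omega) (by omega) (by omega)
        (by omega)
    · have hc : ∃ c, c ≠ .moved ∧ 2 ≤ kindCount (g * a * g⁻¹) c := by
        by_contra! hc
        have h1' := hc .negEven (by simp)
        have h2' := hc .negOdd (by simp)
        have h3' := hc .pos (by simp)
        omega
      obtain ⟨c, hc, hc2⟩ := hc
      exact hg.connected_of_pos (by omega) (by omega) hc hc2 (by omega) (by omega)
  · rintro (⟨hm, hl⟩ | ⟨hm, hl, hk | hk⟩ | ⟨hm, hmax⟩ | ⟨hn4, hm⟩ | ⟨hn6, hm, hke, hko⟩)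
    · exact not_connected_of_all_neg hn (by omega) (by omega)
    · exact not_connected_of_unique_neg (.inl rfl) (by omega) (by omega)
    · exact not_connected_of_unique_neg (.inr rfl) (by omega) (by omega)
    · by_cases hl : l = 0
      · rcases (by omega : ke = 1 ∨ ko = 1) with hk | hk
        · exact not_connected_of_unique_neg (.inl rfl) (by omega) (by omega)
        · exact not_connected_of_unique_neg (.inr rfl) (by omega) (by omega)
      · refine not_connected_of_distinct_fixed_kinds (by omega) ?_ (by omega)
        intro c hc
        cases c
        · exact absurd rfl hc
        all_goals omega
    · exact not_connected_of_four hn4 (by omega)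
    · exact not_connected_of_three_pairs (by omega) (by omega) (by omega) (by omega)
end

section
/- Let X be a conjugacy class of involutions in G_n with labelled cycle type (0,k_e,k_o,0) (that is, m = 0 and l = 0). Then no two distinct elements of X commute; in particular the commuting involution graph C(G_n,X) has no edges and is completely disconnected. -/
namespace AffineWeylC

variable {n : ℕ}

/-- `g` acts on `ℤⁿ` as a point reflection, i.e. its linear part is `-1`. -/
def IsPointReflection (g : AffineWeylC n) : Prop := g.π = 1 ∧ ∀ i, g.s i = -1

lemma isPointReflection_of_numNegEven_add_numNegOdd {g : AffineWeylC n}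
    (h : g.numNegEven + g.numNegOdd = n) : g.IsPointReflection := by
  have hdisj : Disjoint {i : Fin n | g.π i = i ∧ g.s i = -1 ∧ Even (g.v i)}
      {i : Fin n | g.π i = i ∧ g.s i = -1 ∧ Odd (g.v i)} :=
    Set.disjoint_left.mpr fun i he ho => Int.not_odd_iff_even.mpr he.2.2 ho.2.2
  have hcard := Set.ncard_union_eq hdisj
  have huniv : {i : Fin n | g.π i = i ∧ g.s i = -1 ∧ Even (g.v i)} ∪
      {i : Fin n | g.π i = i ∧ g.s i = -1 ∧ Odd (g.v i)} = Set.univ := by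
    refine Set.eq_univ_of_univ_subset (Set.eq_of_subset_of_ncard_le (Set.subset_univ _) ?_).ge
    rw [hcard, Set.ncard_univ, Nat.card_fin]
    exact h.ge
  have hfix : ∀ i, g.π i = i ∧ g.s i = -1 := fun i => by
    rcases huniv.ge (Set.mem_univ i) with hi | hi <;> exact ⟨hi.1, hi.2.1⟩
  exact ⟨Equiv.ext fun i => (hfix i).1, fun i => (hfix i).2⟩

lemma IsPointReflection.of_isConj {a b : AffineWeylC n} (ha : a.IsPointReflection)
    (h : IsConj a b) : b.IsPointReflection := by
  obtain ⟨c, rfl⟩ := isConj_iff.mp h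
  refine ⟨by simp [ha.1], fun i => ?_⟩
  simp [ha.1, ha.2]

lemma IsPointReflection.eq_of_commute {x y : AffineWeylC n} (hx : x.IsPointReflection)
    (hy : y.IsPointReflection) (h : Commute x y) : x = y := by
  refine AffineWeylC.ext (hx.1.trans hy.1.symm)
    (funext fun i => (hx.2 i).trans (hy.2 i).symm) (funext fun i => ?_)
  have hv := congrFun (congrArg AffineWeylC.v h.eq) i
  simp only [mul_v, hx.1, hy.1, hx.2, hy.2, inv_one, Equiv.Perm.one_apply, Units.val_neg,
    Units.val_one] at hv
  linarith

end AffineWeylC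

/-- If `m = 0` and `l = 0` then no two distinct elements of `X`
commute: the commuting involution graph has no edges. -/
theorem stmt_10 (n ke ko : ℕ) (a : AffineWeylC n) (ha : a.Involution)
    (htype : a.HasType 0 ke ko 0) (hsum : ke + ko = n)
    (X : Set (AffineWeylC n)) (hX : X = AffineWeylC.conjClass a) :
    (∀ x ∈ X, ∀ y ∈ X, x ≠ y → ¬ Commute x y) ∧
    (∀ x y : X, ¬ (commGraph X).Adj x y) := by
  subst hX
  have ha' : a.IsPointReflection :=
    AffineWeylC.isPointReflection_of_numNegEven_add_numNegOdd
      (by rw [htype.2.1, htype.2.2.1, hsum])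
  have key : ∀ x ∈ AffineWeylC.conjClass a, ∀ y ∈ AffineWeylC.conjClass a,
      x ≠ y → ¬ Commute x y := fun x hx y hy hne hc =>
    hne ((ha'.of_isConj hx).eq_of_commute (ha'.of_isConj hy) hc)
  exact ⟨key, fun x y hadj => key x x.2 y y.2 hadj.1 hadj.2⟩
end
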